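/- For every prime q with q ≥ 13 there exists a finite simple graph which is (q + 3)-regular, has girth exactly 5, and has at most 2(q² − 1) vertices. -/

import Mathlib

open SimpleGraph

/-- A graph has no triangles and no quadrangles. -/
def NoShortCycle {V : Type*} (G : SimpleGraph V) : Prop :=
  (∀ a b c, G.Adj a b → G.Adj b c → ¬ G.Adj c a) ∧
    ∀ a b c d, G.Adj a b → G.Adj b c → G.Adj c d → G.Adj d a → a = c ∨ b = d

theorem NoShortCycle.five_le_egirth {V : Type*} {G : SimpleGraph V} (h : NoShortCycle G) :
    5 ≤ G.egirth := by
  rw [le_egirth]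
  intro a w hw
  have h3 := hw.three_le_length
  by_contra hlt
  have hlt' : w.length < 5 := by
    by_contra hge
    exact hlt (by exact_mod_cast not_lt.mp hge)
  have hnd := hw.support_nodup
  match w, h3, hlt', hnd with
  | .cons h1 (.cons h2 (.cons h3 .nil)), _, _, _ => exact h.1 _ _ _ h1 h2 h3
  | .cons h1 (.cons h2 (.cons h3 (.cons h4 .nil))), _, _, hnd =>
    have := h.2 _ _ _ _ h1 h2 h3 h4
    simp at hnd
    grind
  | .cons _ (.cons _ (.cons _ (.cons _ (.cons _ p)))), _, hl, _ =>
    simp at hl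
    omega

/-- The local conditions on the sets `N x` of steps available at `x` under which joining `x` to
all `x + a` with `a ∈ N x` gives a cubic graph without triangles and quadrangles. -/
structure IsCubicStepSystem {A : Type*} [AddCommGroup A] (N : A → Finset A) : Prop where
  card : ∀ x, (N x).card = 3
  zero_notMem : ∀ x, 0 ∉ N x
  neg_mem : ∀ x, ∀ a ∈ N x, -a ∈ N (x + a)
  triangle : ∀ x, ∀ a ∈ N x, ∀ b ∈ N (x + a), ∀ c ∈ N (x + a + b), a + b + c ≠ 0
  quadrangle : ∀ x, ∀ a ∈ N x, ∀ b ∈ N (x + a), ∀ c ∈ N (x + a + b), ∀ d ∈ N (x + a + b + c),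
    a + b + c + d = 0 → a + b = 0 ∨ b + c = 0

namespace IsCubicStepSystem

variable {A : Type*} [AddCommGroup A] {N : A → Finset A}

/-- The graph joining `x` to `x + a` for every step `a` available at `x`. -/
def graph (h : IsCubicStepSystem N) : SimpleGraph A where
  Adj x y := y - x ∈ N x
  symm := ⟨fun x y hxy => by simpa using h.neg_mem x _ hxy⟩
  loopless := ⟨fun x hx => h.zero_notMem x (by simpa using hx)⟩

theorem ncard_neighborSet (h : IsCubicStepSystem N) (x : A) :
    (h.graph.neighborSet x).ncard = 3 := by
  have : h.graph.neighborSet x = (fun a => x + a) '' (N x : Set A) := by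
    ext y
    simp [graph, neg_add_eq_sub]
  rw [this, Set.ncard_image_of_injective _ (add_right_injective x), Set.ncard_coe_finset, h.card]

theorem noShortCycle_graph (h : IsCubicStepSystem N) : NoShortCycle h.graph := by
  constructor
  · intro x y z hxy hyz hzx
    exact h.triangle x _ hxy (z - y) (by simpa [graph] using hyz) (x - z)
      (by simpa [graph] using hzx) (by abel)
  · intro x y z w hxy hyz hzw hwx
    have := h.quadrangle x _ hxy (z - y) (by simpa [graph] using hyz) (w - z)
      (by simpa [graph] using hzw) (x - w) (by simpa [graph] using hwx) (by abel)
    refine this.imp (fun h => ?_) (fun h => ?_)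
    · have h' : z - x = 0 := by rw [← h]; abel
      exact (sub_eq_zero.mp h').symm
    · have h' : w - y = 0 := by rw [← h]; abel
      exact (sub_eq_zero.mp h').symm

end IsCubicStepSystem

/-- Two cubic graphs without triangles and quadrangles such that no difference along an edge of
the first is a difference along an edge of the second. -/
def IsCubicPair {A : Type*} [AddCommGroup A] (G H : SimpleGraph A) : Prop :=
  (∀ x, (G.neighborSet x).ncard = 3) ∧ (∀ x, (H.neighborSet x).ncard = 3) ∧
    NoShortCycle G ∧ NoShortCycle H ∧
    ∀ a b c d, G.Adj a b → H.Adj c d → b - a ≠ d - c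

theorem IsCubicStepSystem.isCubicPair {A : Type*} [AddCommGroup A] {M N : A → Finset A}
    (hM : IsCubicStepSystem M) (hN : IsCubicStepSystem N)
    (hMN : ∀ x y, ∀ a ∈ M x, a ∉ N y) : IsCubicPair hM.graph hN.graph :=
  ⟨hM.ncard_neighborSet, hN.ncard_neighborSet, hM.noShortCycle_graph, hN.noShortCycle_graph,
    fun a b c d hab hcd h => hMN a c _ hab (by rw [h]; exact hcd)⟩

/-- Steps of a cubic graph on `ZMod 12` with differences `±1`, `±4` and `±5`. -/
def stepsTwelve (x : ZMod 12) : Finset (ZMod 12) :=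
  ![{1, 4, 5}, {-1, 1, 5}, {-1, 1, -5}, {-1, 4, -5}, {-4, 4, -5}, {-5, 4, 5},
    {-5, 1, 5}, {-4, -1, 1}, {-4, -1, 1}, {5, -4, -1}, {5, -5, 1}, {5, -5, -1}] x

/-- Steps of a cubic graph on `ZMod 12` with differences `±2`, `±3` and `6`. -/
def stepsTwelve' (x : ZMod 12) : Finset (ZMod 12) :=
  ![{2, 3, 6}, {2, -3, -2}, {-2, 2, -3}, {-3, -2, 2}, {-2, 3, 6}, {-2, 2, 3},
    {6, 2, 3}, {-3, -2, 2}, {-3, -2, 2}, {-3, -2, 2}, {3, 6, -2}, {2, 3, -2}] x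

theorem exists_isCubicPair_twelve : ∃ G H : SimpleGraph (ZMod 12), IsCubicPair G H := by
  have h : IsCubicStepSystem stepsTwelve := by constructor <;> decide +kernel
  have h' : IsCubicStepSystem stepsTwelve' := by constructor <;> decide +kernel
  exact ⟨_, _, h.isCubicPair h' (by decide +kernel)⟩

/-- Integer steps depending only on the parity of the current vertex of `ZMod n`. -/
def paritySteps {n : ℕ} (h : 2 ∣ n) (S : ZMod 2 → Finset ℤ) (x : ZMod n) : Finset (ZMod n) :=
  (S (ZMod.castHom h (ZMod 2) x)).image Int.cast

theorem isCubicStepSystem_paritySteps {n : ℕ} (h : 2 ∣ n) {S : ZMod 2 → Finset ℤ}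
    (card : ∀ p, (S p).card = 3)
    (inj : ∀ p, ∀ a ∈ S p, ∀ b ∈ S p, (n : ℤ) ∣ a - b → a = b)
    (zero : ∀ p, ∀ a ∈ S p, ¬ (n : ℤ) ∣ a)
    (neg : ∀ p, ∀ a ∈ S p, -a ∈ S (p + a))
    (tri : ∀ p, ∀ a ∈ S p, ∀ b ∈ S (p + a), ∀ c ∈ S (p + a + b), ¬ (n : ℤ) ∣ a + b + c)
    (quad : ∀ p, ∀ a ∈ S p, ∀ b ∈ S (p + a), ∀ c ∈ S (p + a + b), ∀ d ∈ S (p + a + b + c),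
      (n : ℤ) ∣ a + b + c + d → a + b = 0 ∨ b + c = 0) :
    IsCubicStepSystem (paritySteps h S) where
  card x := by
    rw [paritySteps, Finset.card_image_of_injOn, card]
    intro a ha b hb hab
    refine inj _ a ha b hb ?_
    rw [← ZMod.intCast_zmod_eq_zero_iff_dvd]
    simpa [sub_eq_zero] using hab
  zero_notMem x := by
    simp only [paritySteps, Finset.mem_image, not_exists, not_and]
    intro a ha h0
    exact zero _ a ha ((ZMod.intCast_zmod_eq_zero_iff_dvd _ _).mp h0)
  neg_mem x := by
    simp only [paritySteps, Finset.forall_mem_image, map_add, map_intCast]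
    intro a ha
    exact Finset.mem_image.mpr ⟨-a, neg _ a ha, by simp⟩
  triangle x := by
    simp only [paritySteps, Finset.forall_mem_image, map_add, map_intCast]
    intro a ha b hb c hc h0
    refine tri _ a ha b hb c hc ?_
    rw [← ZMod.intCast_zmod_eq_zero_iff_dvd]
    exact_mod_cast h0
  quadrangle x := by
    simp only [paritySteps, Finset.forall_mem_image, map_add, map_intCast]
    intro a ha b hb c hc d hd h0
    have := quad _ a ha b hb c hc d hd (by
      rw [← ZMod.intCast_zmod_eq_zero_iff_dvd]
      exact_mod_cast h0)
    exact_mod_cast this.imp (congrArg (Int.cast : ℤ → ZMod n)) (congrArg (Int.cast : ℤ → ZMod n))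

theorem paritySteps_disjoint {n : ℕ} (h : 2 ∣ n) {S T : ZMod 2 → Finset ℤ}
    (hST : ∀ p r, ∀ a ∈ S p, ∀ b ∈ T r, ¬ (n : ℤ) ∣ b - a) (x y : ZMod n) :
    ∀ a ∈ paritySteps h S x, a ∉ paritySteps h T y := by
  simp only [paritySteps, Finset.forall_mem_image]
  intro a ha hmem
  obtain ⟨b, hb, hab⟩ := Finset.mem_image.mp hmem
  refine hST _ _ a ha b hb ?_
  rw [← ZMod.intCast_zmod_eq_zero_iff_dvd]
  simpa [sub_eq_zero] using hab

/-- Alternating steps `a, -a, c` at even vertices and `b, -b, -c` at odd vertices, giving a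
generalized Petersen graph, or a Haar graph in the case `a = b`, when `c` is odd. -/
def alternatingSteps (a b c : ℤ) (p : ZMod 2) : Finset ℤ :=
  if p = 0 then {a, -a, c} else {b, -b, -c}

theorem exists_isCubicPair_sixteen : ∃ G H : SimpleGraph (ZMod 16), IsCubicPair G H := by
  let S := alternatingSteps 1 1 5
  let T := alternatingSteps 2 6 3
  have h2 : 2 ∣ 16 := by norm_num
  have hS : IsCubicStepSystem (paritySteps h2 S) := by
    apply isCubicStepSystem_paritySteps <;> decide +kernel
  have hT : IsCubicStepSystem (paritySteps h2 T) := by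
    apply isCubicStepSystem_paritySteps <;> decide +kernel
  exact ⟨_, _, hS.isCubicPair hT (paritySteps_disjoint h2 (by decide +kernel))⟩

theorem exists_isCubicPair_of_eighteen_le {n : ℕ} (h2 : 2 ∣ n) (hn : 18 ≤ n) :
    ∃ G H : SimpleGraph (ZMod n), IsCubicPair G H := by
  let S := alternatingSteps 1 1 5
  let T := alternatingSteps 2 4 3
  have small {k : ℤ} (hk : |k| < 18) (hd : (n : ℤ) ∣ k) : k = 0 :=
    Int.eq_zero_of_abs_lt_dvd hd (by omega)
  have key (U : ZMod 2 → Finset ℤ)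
      (card : ∀ p, (U p).card = 3)
      (inj : ∀ p, ∀ a ∈ U p, ∀ b ∈ U p, |a - b| < 18)
      (zero : ∀ p, ∀ a ∈ U p, |a| < 18 ∧ a ≠ 0)
      (neg : ∀ p, ∀ a ∈ U p, -a ∈ U (p + a))
      (tri : ∀ p, ∀ a ∈ U p, ∀ b ∈ U (p + a), ∀ c ∈ U (p + a + b),
        |a + b + c| < 18 ∧ a + b + c ≠ 0)
      (quad : ∀ p, ∀ a ∈ U p, ∀ b ∈ U (p + a), ∀ c ∈ U (p + a + b), ∀ d ∈ U (p + a + b + c),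
        |a + b + c + d| < 18 ∧ (a + b + c + d = 0 → a + b = 0 ∨ b + c = 0)) :
      IsCubicStepSystem (paritySteps h2 U) :=
    isCubicStepSystem_paritySteps h2 card
      (fun p a ha b hb hd => sub_eq_zero.mp (small (inj p a ha b hb) hd))
      (fun p a ha hd => (zero p a ha).2 (small (zero p a ha).1 hd))
      neg
      (fun p a ha b hb c hc hd =>
        (tri p a ha b hb c hc).2 (small (tri p a ha b hb c hc).1 hd))
      (fun p a ha b hb c hc d hd' hd =>
        (quad p a ha b hb c hc d hd').2 (small (quad p a ha b hb c hc d hd').1 hd))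
  have hS : IsCubicStepSystem (paritySteps h2 S) := by
    apply key <;> decide +kernel
  have hT : IsCubicStepSystem (paritySteps h2 T) := by
    apply key <;> decide +kernel
  have hST : ∀ p r, ∀ a ∈ S p, ∀ b ∈ T r, |b - a| < 18 ∧ b - a ≠ 0 := by decide +kernel
  exact ⟨_, _, hS.isCubicPair hT (paritySteps_disjoint h2 fun p r a ha b hb hd =>
    (hST p r a ha b hb).2 (small (hST p r a ha b hb).1 hd))⟩

theorem exists_isCubicPair_of_prime {q : ℕ} (hq : q.Prime) (h13 : 13 ≤ q) :
    ∃ G H : SimpleGraph (ZMod (q - 1)), IsCubicPair G H := by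
  have hodd : Odd q := hq.odd_of_ne_two (by omega)
  have h2 : 2 ∣ q - 1 := by
    obtain ⟨k, rfl⟩ := hodd
    omega
  rcases lt_or_ge q 19 with h | h
  · interval_cases q
    · exact exists_isCubicPair_twelve
    · omega
    · norm_num at hq
    · omega
    · exact exists_isCubicPair_sixteen
    · omega
  · exact exists_isCubicPair_of_eighteen_le h2 (by omega)

section Plane

variable {K : Type*} [Field K]

/-- The standard bilinear form of `K × K` on representatives `(0, 1)` and `(1, s)` of the points
of the projective line. -/
def projDot : Option K → Option K → K
  | none, none => 1
  | none, some t => t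
  | some s, none => s
  | some s, some t => 1 + s * t

theorem projDot_comm (x y : Option K) : projDot x y = projDot y x := by
  cases x <;> cases y <;> simp [projDot, mul_comm]

theorem projDot_cross {x x' y y' : Option K}
    (h : projDot x y * projDot x' y' = projDot x y' * projDot x' y) : x = x' ∨ y = y' := by
  cases x <;> cases x' <;> cases y <;> cases y' <;> simp [projDot] at h ⊢ <;> grind

theorem exists_projDot_eq_zero_iff (x : Option K) : ∃ y₀, ∀ y, projDot x y = 0 ↔ y = y₀ := by
  rcases x with _ | s
  · refine ⟨some 0, fun y => ?_⟩
    cases y <;> simp [projDot]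
  · by_cases hs : s = 0
    · refine ⟨none, fun y => ?_⟩
      cases y <;> simp [projDot, hs]
    · refine ⟨some (-s⁻¹), fun y => ?_⟩
      cases y <;> simp [projDot, hs]
      grind

/-- The graph on two copies of the nonzero vectors `a • x` of `K × K`, where `x` is a
representative of a projective point. Vectors in different copies are adjacent when their dot
product is `1`; two multiples of `x` in the copy `i` are adjacent as prescribed by `G i`. -/
def planeGraph (G : Bool → SimpleGraph Kˣ) : SimpleGraph (Bool × Option K × Kˣ) where
  Adj v w := (v.1 = w.1 ∧ v.2.1 = w.2.1 ∧ (G v.1).Adj v.2.2 w.2.2) ∨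
    (v.1 ≠ w.1 ∧ (v.2.2 * w.2.2 : K) * projDot v.2.1 w.2.1 = 1)
  symm := ⟨by
    rintro ⟨i, x, a⟩ ⟨j, y, b⟩ (⟨h1, h2, h3⟩ | ⟨h1, h2⟩)
    · dsimp only at h1 h2 h3
      subst h1
      exact Or.inl ⟨rfl, h2.symm, h3.symm⟩
    · exact Or.inr ⟨h1.symm, by rw [mul_comm (b : K), projDot_comm]; exact h2⟩⟩
  loopless := ⟨by
    rintro ⟨i, x, a⟩ (⟨-, -, h⟩ | ⟨h, -⟩)
    · exact h.ne rfl
    · exact h rfl⟩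

theorem ncard_neighborSet_planeGraph [Finite K] {G : Bool → SimpleGraph Kˣ}
    {k : ℕ} (hG : ∀ i a, ((G i).neighborSet a).ncard = k) (v : Bool × Option K × Kˣ) :
    ((planeGraph G).neighborSet v).ncard = Nat.card K + k := by
  obtain ⟨i, x, a⟩ := v
  set L : Set (Bool × Option K × Kˣ) := (fun b => (i, x, b)) '' (G i).neighborSet a with hL
  set C : Set (Bool × Option K × Kˣ) :=
    {w | i ≠ w.1 ∧ (a * w.2.2 : K) * projDot x w.2.1 = 1} with hC
  have hunion : (planeGraph G).neighborSet (i, x, a) = C ∪ L := by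
    ext ⟨j, y, b⟩
    simp only [planeGraph, mem_neighborSet, hL, hC, Set.mem_union, Set.mem_image,
      Set.mem_ofPred_eq, Prod.mk.injEq]
    grind
  have hdisj : Disjoint C L := by
    rw [Set.disjoint_left]
    rintro w ⟨h, -⟩ ⟨b, -, rfl⟩
    exact h rfl
  have hLcard : L.ncard = k := by
    rw [hL, Set.ncard_image_of_injective _ (fun b c h => by simpa using h), hG]
  have hCcard : C.ncard = Nat.card K := by
    have hinj : Set.InjOn (fun w : Bool × Option K × Kˣ => w.2.1) C := by
      rintro ⟨j, y, b⟩ ⟨hj, hb⟩ ⟨j', y', b'⟩ ⟨hj', hb'⟩ rfl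
      dsimp only at hj hb hj' hb'
      have hjj : j = j' := (Bool.eq_not.mpr hj.symm).trans (Bool.eq_not.mpr hj'.symm).symm
      have hbb : b = b' := by
        ext
        grind
      rw [hjj, hbb]
    obtain ⟨y₀, hy₀⟩ := exists_projDot_eq_zero_iff x
    have himage : (fun w : Bool × Option K × Kˣ => w.2.1) '' C = {y₀}ᶜ := by
      ext y
      simp only [Set.mem_image, Set.mem_compl_iff, Set.mem_singleton_iff, ← hy₀]
      constructor
      · rintro ⟨⟨j, y, b⟩, ⟨-, hb⟩, rfl⟩ h0
        simp [h0] at hb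
      · intro hy
        refine ⟨(!i, y, (a * Units.mk0 _ hy)⁻¹), ⟨by simp, ?_⟩, rfl⟩
        have := a.ne_zero
        simp
        field_simp
    rw [← hinj.ncard_image, himage, Set.ncard_compl, Set.ncard_singleton]
    simp
  rw [hunion, Set.ncard_union_eq hdisj, hCcard, hLcard]

theorem noShortCycle_planeGraph {G : Bool → SimpleGraph Kˣ} (hG : ∀ i, NoShortCycle (G i))
    (hdisj : ∀ i j, i ≠ j → ∀ a b c d, (G i).Adj a b → (G j).Adj c d → a * c ≠ b * d) :
    NoShortCycle (planeGraph G) := by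
  have unique {a b c : Kˣ} {x y : Option K} (h : (a * c : K) * projDot x y = 1)
      (h' : (b * c : K) * projDot x y = 1) : a = b := by
    ext
    grind
  have unique' {a b c : Kˣ} {x y : Option K} (h : (c * a : K) * projDot x y = 1)
      (h' : (c * b : K) * projDot x y = 1) : a = b := by
    ext
    grind
  have parallel {a b c d : Kˣ} {x y : Option K} (h : (a * c : K) * projDot x y = 1)
      (h' : (b * d : K) * projDot x y = 1) : a * c = b * d := by
    ext
    push_cast
    grind
  have cross {a b c d : Kˣ} {x x' y y' : Option K} (h1 : (a * c : K) * projDot x y = 1)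
      (h2 : (b * c : K) * projDot x' y = 1) (h3 : (b * d : K) * projDot x' y' = 1)
      (h4 : (a * d : K) * projDot x y' = 1) : (x = x' ∧ a = b) ∨ (y = y' ∧ c = d) := by
    have : projDot x y * projDot x' y' = projDot x y' * projDot x' y := by
      have hne : (a * b * c * d : K) ≠ 0 := by simp
      apply mul_left_cancel₀ hne
      linear_combination (b * d * projDot x' y' : K) * h1 + h3 - (b * c * projDot x' y : K) * h4 - h2
    rcases projDot_cross this with rfl | rfl
    · exact Or.inl ⟨rfl, unique h1 h2⟩
    · exact Or.inr ⟨rfl, unique' h1 h4⟩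
  have comm {a b : Kˣ} {x y : Option K} (h : (a * b : K) * projDot x y = 1) :
      (b * a : K) * projDot y x = 1 := by
    rw [mul_comm (b : K), projDot_comm]
    exact h
  have odd : ∀ {i j k : Bool}, i ≠ j → j ≠ k → k ≠ i → False := by decide
  constructor
  · rintro ⟨i, x, a⟩ ⟨j, y, b⟩ ⟨k, z, c⟩ h1 h2 h3
    simp only [planeGraph] at h1 h2 h3
    rcases h1 with ⟨rfl, rfl, h1⟩ | ⟨n1, h1⟩ <;> rcases h2 with ⟨rfl, rfl, h2⟩ | ⟨n2, h2⟩ <;>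
      rcases h3 with ⟨h3i, h3x, h3⟩ | ⟨n3, h3⟩
    · exact (hG _).1 _ _ _ h1 h2 h3
    · exact n3 rfl
    · exact n2 h3i.symm
    · exact h1.ne (unique (comm h3) h2)
    · exact n1 h3i.symm
    · exact h2.ne (unique' h1 (comm h3))
    · subst h3i h3x
      exact h3.ne (unique (comm h2) h1)
    · exact odd n1 n2 n3
  · rintro ⟨i, x, a⟩ ⟨j, y, b⟩ ⟨k, z, c⟩ ⟨l, w, d⟩ h1 h2 h3 h4
    simp only [planeGraph] at h1 h2 h3 h4
    simp only [Prod.mk.injEq]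
    rcases h1 with ⟨rfl, rfl, h1⟩ | ⟨n1, h1⟩ <;> rcases h2 with ⟨rfl, rfl, h2⟩ | ⟨n2, h2⟩ <;>
      rcases h3 with ⟨rfl, rfl, h3⟩ | ⟨n3, h3⟩ <;> rcases h4 with ⟨h4i, h4x, h4⟩ | ⟨n4, h4⟩
    · exact ((hG _).2 _ _ _ _ h1 h2 h3 h4).imp (⟨rfl, rfl, ·⟩) (⟨rfl, rfl, ·⟩)
    · exact absurd rfl n4
    · exact absurd h4i.symm n3
    · exact Or.inl ⟨rfl, rfl, unique (comm h4) h3⟩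
    · exact absurd h4i.symm n2
    · exact absurd (parallel h2 (comm h4)) (hdisj _ _ n2 _ _ _ _ h1.symm h3)
    · subst h4i h4x
      exact Or.inr ⟨rfl, rfl, unique h2 (comm h3)⟩
    · exact (odd n2 n3 n4).elim
    · exact absurd h4i.symm n1
    · exact Or.inr ⟨rfl, rfl, unique' h1 (comm h4)⟩
    · subst h4i h4x
      exact absurd (parallel h1 (comm h3)) (hdisj _ _ n1 _ _ _ _ h4.symm h2)
    · exact (odd n1 n3 n4).elim
    · subst h4i h4x
      exact Or.inl ⟨rfl, rfl, unique h1 (comm h2)⟩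
    · exact (odd n1 n2 n4).elim
    · subst h4i
      exact (odd n1 n2 n3).elim
    · have hik : i = k := (Bool.eq_not.mpr n1).trans (Bool.eq_not.mpr n2.symm).symm
      have hjl : j = l := (Bool.eq_not.mpr n2).trans (Bool.eq_not.mpr n3.symm).symm
      exact (cross h1 (comm h2) h3 (comm h4)).imp (⟨hik, ·⟩) (⟨hjl, ·⟩)

theorem egirth_planeGraph_le {G : Bool → SimpleGraph Kˣ} {a b : Kˣ} (hab : (G false).Adj a b) :
    (planeGraph G).egirth ≤ 5 := by
  have hne : (a : K) ≠ b := fun h => hab.ne (Units.ext h)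
  have hs : (a : K) / (b - a) ≠ 0 := div_ne_zero a.ne_zero (sub_ne_zero.mpr hne.symm)
  have hba : (b : K) - a ≠ 0 := sub_ne_zero.mpr hne.symm
  have ha := a.ne_zero
  have hb := b.ne_zero
  let v : Bool × Option K × Kˣ := (false, none, a)
  let v' : Bool × Option K × Kˣ := (false, none, b)
  let w : Bool × Option K × Kˣ := (true, none, a⁻¹)
  let w' : Bool × Option K × Kˣ := (true, some 1, b⁻¹)
  let u : Bool × Option K × Kˣ := (false, some (a / (b - a)), a * (Units.mk0 _ hs)⁻¹)
  have h1 : (planeGraph G).Adj v v' := Or.inl ⟨rfl, rfl, hab⟩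
  have h2 : (planeGraph G).Adj v' w' := Or.inr ⟨by simp [v', w'], by simp [v', w', projDot]⟩
  have h3 : (planeGraph G).Adj w' u := Or.inr ⟨by simp [u, w'], by
    simp [u, w', projDot]
    field_simp
    ring⟩
  have h4 : (planeGraph G).Adj u w := Or.inr ⟨by simp [u, w], by
    simp [u, w, projDot]
    field_simp⟩
  have h5 : (planeGraph G).Adj w v := Or.inr ⟨by simp [v, w], by simp [v, w, projDot]⟩
  let p : (planeGraph G).Walk v v := .cons h1 (.cons h2 (.cons h3 (.cons h4 (.cons h5 .nil))))
  have hp : p.IsCycle := by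
    have hvv : v ≠ v' := h1.ne
    have hvw' : v ≠ w' := by simp [v, w']
    have hvu : v ≠ u := by simp [v, u]
    have hvw : v ≠ w := by simp [v, w]
    have hv'w' : v' ≠ w' := by simp [v', w']
    have hv'u : v' ≠ u := by simp [v', u]
    have hv'w : v' ≠ w := by simp [v', w]
    have hw'u : w' ≠ u := by simp [w', u]
    have hww : w' ≠ w := by simp [w', w]
    have huw : u ≠ w := by simp [u, w]
    clear_value v v' w w' u
    simp [p, Walk.cons_isCycle_iff, Walk.isPath_def, *, hvv.symm, hvw'.symm, hvu.symm, hvw.symm]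
  exact_mod_cast egirth_le_length hp

end Plane

theorem NoShortCycle.comap {V W : Type*} {G : SimpleGraph W} (h : NoShortCycle G) {f : V → W}
    (hf : f.Injective) : NoShortCycle (G.comap f) :=
  ⟨fun _ _ _ => h.1 _ _ _,
    fun _ _ _ _ h1 h2 h3 h4 => (h.2 _ _ _ _ h1 h2 h3 h4).imp (@hf _ _) (@hf _ _)⟩

theorem ncard_neighborSet_comap_equiv {V W : Type*} (G : SimpleGraph W) (e : V ≃ W) (v : V) :
    ((G.comap e).neighborSet v).ncard = (G.neighborSet (e v)).ncard := by
  have : G.neighborSet (e v) = e '' (G.comap e).neighborSet v := by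
    ext w
    simp [Equiv.image_eq_preimage_symm]
  rw [this, Set.ncard_image_of_injective _ e.injective]

theorem IsCubicPair.exists_mul {C : Type*} [CommGroup C] [IsCyclic C] {n : ℕ}
    (hn : Nat.card C = n) {G H : SimpleGraph (ZMod n)} (h : IsCubicPair G H) :
    ∃ F : Bool → SimpleGraph C, (∀ i a, ((F i).neighborSet a).ncard = 3) ∧
      (∀ i, NoShortCycle (F i)) ∧
      ∀ i j, i ≠ j → ∀ a b c d, (F i).Adj a b → (F j).Adj c d → a * c ≠ b * d := by
  subst hn
  obtain ⟨hG, hH, hG', hH', hGH⟩ := h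
  let e : C ≃ ZMod (Nat.card C) :=
    (zmodCyclicMulEquiv (G := C) inferInstance).symm.toEquiv.trans Multiplicative.toAdd
  have he (a b : C) : e (a * b) = e a + e b := by simp [e]
  refine ⟨fun i => (bif i then H else G).comap e, ?_, ?_, ?_⟩
  · rintro (_ | _) a
    · exact (ncard_neighborSet_comap_equiv G e a).trans (hG _)
    · exact (ncard_neighborSet_comap_equiv H e a).trans (hH _)
  · rintro (_ | _)
    · exact hG'.comap e.injective
    · exact hH'.comap e.injective
  · have key (a b c d : C) (hab : G.Adj (e a) (e b)) (hcd : H.Adj (e c) (e d)) :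
        a * c ≠ b * d := by
      intro h
      have h' : e a + e c = e b + e d := by rw [← he, ← he, h]
      exact hGH _ _ _ _ hab hcd.symm (by linear_combination -h')
    rintro (_ | _) (_ | _) hij a b c d hab hcd
    · exact absurd rfl hij
    · exact key a b c d hab hcd
    · rw [mul_comm a, mul_comm b]
      exact key c d a b hcd hab
    · exact absurd rfl hij

/-- For every prime `q ≥ 13` there is a `(q + 3)`-regular graph of girth exactly `5`
with at most `2 * (q ^ 2 - 1)` vertices. -/
theorem exists_regular_girth_five_of_prime (q : ℕ) (hq : Nat.Prime q) (h13 : 13 ≤ q) :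
    ∃ (V : Type) (G : SimpleGraph V), Finite V ∧
      (∀ v, (G.neighborSet v).ncard = q + 3) ∧
      G.egirth = 5 ∧
      Nat.card V ≤ 2 * (q ^ 2 - 1) := by
  have : Fact q.Prime := ⟨hq⟩
  have hcard : Nat.card (ZMod q) = q := Nat.card_zmod q
  obtain ⟨G, H, hGH⟩ := exists_isCubicPair_of_prime hq h13
  have hunits : Nat.card (ZMod q)ˣ = q - 1 := by rw [Nat.card_units, hcard]
  obtain ⟨F, hF, hF', hdisj⟩ := hGH.exists_mul hunits
  refine ⟨Bool × Option (ZMod q) × (ZMod q)ˣ, planeGraph F, inferInstance, fun v => ?_,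
    le_antisymm ?_ (noShortCycle_planeGraph hF' hdisj).five_le_egirth, ?_⟩
  · rw [ncard_neighborSet_planeGraph hF, hcard]
  · obtain ⟨b, hb⟩ : ((F false).neighborSet 1).Nonempty := by
      apply Set.nonempty_of_ncard_ne_zero
      rw [hF]
      norm_num
    exact egirth_planeGraph_le hb
  · rw [Nat.card_prod, Nat.card_prod, hunits, Finite.card_option, hcard,
      Nat.card_eq_fintype_card, Fintype.card_bool, ← Nat.sq_sub_sq q 1, one_pow]
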